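/- Let T_0 ∈ (0, π) with 2π/T_0 ∉ ℕ, and set N := ⌊2π/T_0⌋ and j := ⌊π/T_0⌋. If both N and j are even, then T_opt(T_0) = 2π + j·T_0; in particular the set { t > 0 : μ((D(T_0,t))ᶜ) = 0 } is nonempty. -/

import Mathlib

open MeasureTheory Set Real Filter Topology

noncomputable section

instance : Fact (0 < 2 * Real.pi) := ⟨by positivity⟩

/-- λ_k: 0 for even k, π for odd k. -/
def lam (k : ℕ) : ℝ := if Even k then 0 else Real.pi

/-- Covered set D(T₀, t) ⊆ ℝ/(2πℤ): the union over k of the projections of the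
observation intervals (k·T₀, min((k+1)·T₀, t)) translated by −λ_k. -/
def coveredSet (T0 t : ℝ) : Set (AddCircle (2 * Real.pi)) :=
  ⋃ k : ℕ, (fun a : ℝ => ((a - lam k : ℝ) : AddCircle (2 * Real.pi))) ''
    Set.Ioo ((k : ℝ) * T0) (min (((k : ℝ) + 1) * T0) t)

/-- Optimal control time T_opt(T₀). -/
def Topt (T0 : ℝ) : ℝ :=
  sInf { t : ℝ | 0 < t ∧ volume (coveredSet T0 t)ᶜ = 0 }

lemma aux_null (C : Set ℝ) (hC : C.Countable) :
    volume ((fun x : ℝ => (x : AddCircle (2 * Real.pi))) '' C) = 0 := by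
  rw [← biUnion_of_singleton ((fun x : ℝ => (x : AddCircle (2 * Real.pi))) '' C),
    measure_biUnion_null_iff (hC.image _)]
  intro y _
  rw [← Metric.closedBall_zero, AddCircle.volume_closedBall]
  have := Real.pi_pos
  simp [this.le]

lemma aux_floor {T x : ℝ} (hT : 0 < T) (hx : 0 ≤ x) :
    ∃ m : ℕ, (m : ℝ) * T ≤ x ∧ x < ((m : ℝ) + 1) * T := by
  refine ⟨⌊x / T⌋₊, ?_, ?_⟩
  · rw [← le_div_iff₀ hT]; exact Nat.floor_le (by positivity)
  · rw [← div_lt_iff₀ hT]; exact Nat.lt_floor_add_one _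

lemma aux_nat_lt {T : ℝ} {m n : ℕ} (hT : 0 < T) (h : (m : ℝ) * T < ((n : ℝ) + 1) * T) : m ≤ n := by
  have := lt_of_mul_lt_mul_right h hT.le
  have h2 : m < n + 1 := by exact_mod_cast this
  omega

lemma aux_cov {T t a : ℝ} (x : ℝ) (k : ℕ) (n : ℤ) (h1 : (k : ℝ) * T < a)
    (h2 : a < ((k : ℝ) + 1) * T) (h3 : a < t) (h4 : a - lam k = x + n * (2 * Real.pi)) :
    (x : AddCircle (2 * Real.pi)) ∈ coveredSet T t := by
  refine mem_iUnion.2 ⟨k, a, ⟨h1, lt_min h2 h3⟩, ?_⟩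
  simp only [h4]
  rw [← sub_eq_zero, ← AddCircle.coe_sub, AddCircle.coe_eq_zero_iff]
  exact ⟨n, by simp⟩

lemma aux_data (T0 : ℝ) (hT0 : T0 ∈ Set.Ioo 0 Real.pi)
    (hnotnat : ¬ ∃ m : ℕ, 2 * Real.pi / T0 = (m : ℝ))
    (N j : ℕ) (hN : N = ⌊2 * Real.pi / T0⌋₊) (hj : j = ⌊Real.pi / T0⌋₊)
    (hNe : Even N) (hje : Even j) :
    2 ≤ j ∧ ∃ δ : ℝ, 0 < δ ∧ 2 * δ < T0 ∧ Real.pi = j * T0 + δ := by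
  obtain ⟨h0, h1⟩ := hT0
  have hp := Real.pi_pos
  have a1 : (j : ℝ) ≤ Real.pi / T0 := by rw [hj]; exact Nat.floor_le (by positivity)
  have a2 : Real.pi / T0 < j + 1 := by rw [hj]; exact Nat.lt_floor_add_one _
  have b1 : (N : ℝ) ≤ 2 * Real.pi / T0 := by rw [hN]; exact Nat.floor_le (by positivity)
  have b2 : 2 * Real.pi / T0 < N + 1 := by rw [hN]; exact Nat.lt_floor_add_one _
  rw [le_div_iff₀ h0] at a1 b1
  rw [div_lt_iff₀ h0] at a2 b2
  have c1 : 2 * j ≤ N := by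
    apply aux_nat_lt h0; push_cast; nlinarith
  have c2 : N ≤ 2 * j + 1 := by
    apply aux_nat_lt h0; push_cast; nlinarith
  have c3 : N = 2 * j := by
    obtain ⟨u, hu⟩ := hNe; omega
  have c4 : 1 ≤ j := by
    apply aux_nat_lt h0; push_cast; nlinarith
  refine ⟨by obtain ⟨u, hu⟩ := hje; omega, Real.pi - j * T0, ?_, ?_, by ring⟩
  · rcases a1.lt_or_eq with h | h
    · linarith
    · exact absurd ⟨2 * j, by rw [← h]; push_cast; field_simp⟩ hnotnat
  · rw [c3] at b2; push_cast at b2; linarith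

lemma aux_upper (T δ : ℝ) (j : ℕ) (hT : 0 < T) (hδ : 0 < δ) (hδ2 : 2 * δ < T) (hj2 : 2 ≤ j)
    (hje : Even j) (hpi : Real.pi = j * T + δ) :
    volume (coveredSet T (2 * Real.pi + j * T))ᶜ = 0 := by
  refine measure_mono_null ?_ (aux_null (range fun p : ℤ × ℤ => (p.1 : ℝ) * T + p.2 * Real.pi)
    (countable_range _))
  intro y hy
  by_contra hyC
  apply hy
  clear hy
  obtain ⟨x, ⟨hx0, hx1⟩, rfl⟩ : ∃ x ∈ Ico (0 : ℝ) (0 + 2 * Real.pi),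
      (x : AddCircle (2 * Real.pi)) = y := by
    have := AddCircle.coe_image_Ico_eq (2 * Real.pi) 0
    have h : y ∈ (univ : Set (AddCircle (2 * Real.pi))) := mem_univ y
    rw [← this] at h
    exact h
  have hx : ∀ p q : ℤ, x ≠ p * T + q * Real.pi := by
    intro p q h
    exact hyC ⟨x, ⟨(p, q), h.symm⟩, rfl⟩
  clear hyC
  have hjT : (2 : ℝ) * T ≤ j * T := by
    have : (2 : ℝ) ≤ j := by exact_mod_cast hj2
    nlinarith
  obtain ⟨m, hm1, hm2⟩ := aux_floor hT hx0
  have hm1' : (m : ℝ) * T < x := lt_of_le_of_ne hm1 (fun h => hx m 0 (by push_cast; linarith))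
  by_cases hme : Even m
  · refine aux_cov x m 0 hm1' hm2 (by nlinarith) ?_
    simp [lam, hme]
  have hmj : m ≤ 2 * j := by
    apply aux_nat_lt hT; push_cast; nlinarith
  rcases lt_or_ge m j with hlt | hge
  · have hc : ((m : ℝ) + 1) * T ≤ j * T := by
      have : (m : ℝ) + 1 ≤ j := by exact_mod_cast hlt
      nlinarith
    rcases lt_or_ge x (((m : ℝ) + 1) * T - δ) with h | h
    · refine aux_cov (a := x + Real.pi) x (m + j) 0 ?_ ?_ ?_ ?_
      · push_cast; nlinarith
      · push_cast; nlinarith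
      · nlinarith
      · have : ¬ Even (m + j) := by grind
        simp [lam, this]
    · have h' : ((m : ℝ) + 1) * T - δ < x := lt_of_le_of_ne h
        (fun h => hx (m + 1 + j) (-1) (by push_cast; rw [hpi, ← h]; ring))
      refine aux_cov (a := x + 2 * Real.pi) x (m + 1 + 2 * j) 1 ?_ ?_ ?_ ?_
      · push_cast; nlinarith
      · push_cast; nlinarith
      · nlinarith
      · have : Even (m + 1 + 2 * j) := by grind
        simp [lam, this]
  · have hge' : j + 1 ≤ m := by grind
    have hle : m + 1 ≤ 2 * j := by grind
    have hc : ((m : ℝ) + 1) * T ≤ 2 * j * T := by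
      have : (m : ℝ) + 1 ≤ 2 * j := by exact_mod_cast hle
      nlinarith
    rcases lt_or_ge ((m : ℝ) * T + δ) x with h | h
    · have e : ((m - j : ℕ) : ℝ) = m - j := by push_cast [hge]; ring
      refine aux_cov (a := x - Real.pi) x (m - j) (-1) ?_ ?_ ?_ ?_
      · rw [e]; nlinarith
      · rw [e]; nlinarith
      · nlinarith
      · have : ¬ Even (m - j) := by grind
        simp only [lam, this, if_false]; push_cast; ring
    · have h' : x < (m : ℝ) * T + δ := lt_of_le_of_ne h
        (fun h => hx (m - j) 1 (by push_cast; rw [hpi, h]; ring))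
      refine aux_cov (a := x + Real.pi) x (m + j) 0 ?_ ?_ ?_ ?_
      · push_cast; nlinarith
      · push_cast; nlinarith
      · nlinarith
      · have : ¬ Even (m + j) := by grind
        simp [lam, this]

lemma aux_lower (T δ t : ℝ) (j : ℕ) (hT : 0 < T) (hδ : 0 < δ) (hδ2 : 2 * δ < T) (hj2 : 2 ≤ j)
    (hje : Even j) (hpi : Real.pi = j * T + δ) (h0 : volume (coveredSet T t)ᶜ = 0) :
    2 * Real.pi + j * T ≤ t := by
  by_contra! ht
  have hp := Real.pi_pos
  have hjT : (2 : ℝ) * T ≤ j * T := by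
    have : (2 : ℝ) ≤ j := by exact_mod_cast hj2
    nlinarith
  set U := (fun x : ℝ => (x : AddCircle (2 * Real.pi))) '' Ioo (max (j * T - δ) (t - 2 * Real.pi)) (j * T)
    with hU
  have hUo : IsOpen U := QuotientAddGroup.isOpenMap_coe _ isOpen_Ioo
  have hUn : U.Nonempty := (nonempty_Ioo.2 (max_lt (by linarith) (by linarith))).image _
  have hpos := hUo.measure_pos volume hUn
  have hsub : U ⊆ (coveredSet T t)ᶜ := by
    rintro _ ⟨x, ⟨hx1, hx2⟩, rfl⟩ hmem
    obtain ⟨hxa, hxb⟩ := max_lt_iff.1 hx1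
    obtain ⟨k, a, ⟨ha1, ha2⟩, ha3⟩ := mem_iUnion.1 hmem
    obtain ⟨ha2, ha4⟩ := lt_min_iff.1 ha2
    have hk0 : (0 : ℝ) ≤ k * T := by positivity
    obtain ⟨n, hn⟩ : ∃ n : ℤ, a - lam k = x + n * (2 * Real.pi) := by
      have h := sub_eq_zero.2 ha3
      simp only [← AddCircle.coe_sub] at h
      obtain ⟨n, hn⟩ := (AddCircle.coe_eq_zero_iff _).1 h
      rw [zsmul_eq_mul] at hn
      exact ⟨n, by linarith⟩
    have hn0 : n = 0 ∨ 1 ≤ n ∨ n ≤ -1 := by omega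
    by_cases hke : Even k
    · simp only [lam, hke, if_true] at hn
      rcases hn0 with rfl | h | h
      · push_cast at hn
        have u1 : k ≤ j - 1 := by
          have e : ((j - 1 : ℕ) : ℝ) = j - 1 := by rw [Nat.cast_sub (by omega)]; simp
          apply aux_nat_lt hT; rw [e]; nlinarith
        have u2 : j ≤ k + 1 := by
          apply aux_nat_lt hT; push_cast; nlinarith
        grind
      · have : (1 : ℝ) ≤ n := by exact_mod_cast h
        nlinarith
      · have : (n : ℝ) ≤ -1 := by exact_mod_cast h
        nlinarith
    · simp only [lam, hke, if_false] at hn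
      rcases hn0 with rfl | h | h
      · push_cast at hn
        have u1 : k ≤ 2 * j := by
          apply aux_nat_lt hT; push_cast; nlinarith
        have u2 : 2 * j ≤ k := by
          apply aux_nat_lt hT; push_cast; nlinarith
        grind
      · have : (1 : ℝ) ≤ n := by exact_mod_cast h
        nlinarith
      · have : (n : ℝ) ≤ -1 := by exact_mod_cast h
        nlinarith
  exact hpos.ne' (measure_mono_null hsub h0)

/-- Lemma 1.8 i): T₀ ∈ (0,π), 2π/T₀ ∉ ℕ, N = ⌊2π/T₀⌋ and j = ⌊π/T₀⌋ both even. Then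
the system is observable and T_opt = 2π + j·T₀. -/
theorem stmt_12 (T0 : ℝ) (hT0 : T0 ∈ Set.Ioo 0 Real.pi)
    (hnotnat : ¬ ∃ m : ℕ, 2 * Real.pi / T0 = (m : ℝ))
    (N j : ℕ) (hN : N = ⌊2 * Real.pi / T0⌋₊) (hj : j = ⌊Real.pi / T0⌋₊)
    (hNe : Even N) (hje : Even j) :
    { t : ℝ | 0 < t ∧ volume (coveredSet T0 t)ᶜ = 0 }.Nonempty ∧
      Topt T0 = 2 * Real.pi + (j : ℝ) * T0 := by
  obtain ⟨hj2, δ, hδ, hδ2, hpi⟩ := aux_data T0 hT0 hnotnat N j hN hj hNe hje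
  have hT := hT0.1
  have hp := Real.pi_pos
  have hl : IsLeast { t : ℝ | 0 < t ∧ volume (coveredSet T0 t)ᶜ = 0 } (2 * Real.pi + (j : ℝ) * T0) :=
    ⟨⟨by positivity, aux_upper T0 δ j hT hδ hδ2 hj2 hje hpi⟩,
      fun t ht => aux_lower T0 δ t j hT hδ hδ2 hj2 hje hpi ht.2⟩
  exact ⟨hl.nonempty, hl.csInf_eq⟩
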